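/- Let S be a 0-left cancellative semigroup with zero that is categorical at zero, let r ∈ S, and let σ be a maximal string with σ ∈ E⋆_r. Then θ⋆_r^{-1}(σ) = r^{-1}∗σ = {t ∈ S : rt ∈ σ} is a maximal string. -/

import Mathlib

/-- A semigroup with zero is `0`-left cancellative if `s*t = s*r ≠ 0` implies `t = r`. -/
def ZeroLeftCancellative (S : Type*) [SemigroupWithZero S] : Prop :=
  ∀ s t r : S, s * t = s * r → s * t ≠ 0 → t = r

/-- `s` divides `t` when `t ∈ {s} ∪ sS`. -/
def Divides {S : Type*} [Mul S] (s t : S) : Prop := t = s ∨ ∃ u, s * u = t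

/-- A string in `S`: a nonempty subset not containing `0`, closed under divisors,
and directed with respect to divisibility. -/
def IsString {S : Type*} [SemigroupWithZero S] (σ : Set S) : Prop :=
  σ.Nonempty ∧ (0 : S) ∉ σ ∧
  (∀ s t : S, Divides s t → t ∈ σ → s ∈ σ) ∧
  (∀ s₁ ∈ σ, ∀ s₂ ∈ σ, ∃ s ∈ σ, Divides s₁ s ∧ Divides s₂ s)

/-- `r ∗ σ`, the set of divisors of elements of `rσ`. -/
def star {S : Type*} [SemigroupWithZero S] (r : S) (σ : Set S) : Set S :=
  {t | ∃ s ∈ σ, Divides t (r * s)}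

/-- `r⁻¹ ∗ σ = {t ∈ S : rt ∈ σ}`. -/
def starInv {S : Type*} [SemigroupWithZero S] (r : S) (σ : Set S) : Set S :=
  {t | r * t ∈ σ}

/-- `F⋆_r`, the domain of `θ⋆_r`: the strings `σ` with `0 ∉ rσ`. -/
def Fstar {S : Type*} [SemigroupWithZero S] (r : S) : Set (Set S) :=
  {σ | IsString σ ∧ ∀ s ∈ σ, r * s ≠ 0}

/-- `E⋆_r`, the range of `θ⋆_r`: the strings `σ` with `σ ∩ rS ≠ ∅`. -/
def Estar {S : Type*} [SemigroupWithZero S] (r : S) : Set (Set S) :=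
  {σ | IsString σ ∧ ∃ t ∈ σ, ∃ x, t = r * x}

section Divides

variable {S : Type*} [SemigroupWithZero S] {r s t u : S}

theorem Divides.refl (s : S) : Divides s s := Or.inl rfl

theorem Divides.trans (hst : Divides s t) (htu : Divides t u) : Divides s u := by
  rcases hst with rfl | ⟨a, rfl⟩
  · exact htu
  · rcases htu with rfl | ⟨b, rfl⟩
    · exact Or.inr ⟨a, rfl⟩
    · exact Or.inr ⟨a * b, (mul_assoc s a b).symm⟩

theorem Divides.mul_left (r : S) (h : Divides s t) : Divides (r * s) (r * t) := by
  rcases h with rfl | ⟨a, rfl⟩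
  · exact Divides.refl _
  · exact Or.inr ⟨a, mul_assoc r s a⟩

theorem Divides.ne_zero (h : Divides s t) (ht : t ≠ 0) : s ≠ 0 := by
  rintro rfl
  rcases h with rfl | ⟨a, rfl⟩
  · exact ht rfl
  · exact ht (zero_mul a)

theorem Divides.exists_eq_mul (h : Divides (r * s) t) : ∃ a, t = r * a ∧ Divides s a := by
  rcases h with rfl | ⟨a, rfl⟩
  · exact ⟨s, rfl, Divides.refl s⟩
  · exact ⟨s * a, mul_assoc r s a, Or.inr ⟨a, rfl⟩⟩

theorem Divides.of_mul_left (hlc : ZeroLeftCancellative S) (h : Divides (r * s) (r * t))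
    (ht : r * t ≠ 0) : Divides s t := by
  obtain ⟨a, ha, hsa⟩ := h.exists_eq_mul
  rwa [hlc r t a ha ht]

end Divides

section IsString

variable {S : Type*} [SemigroupWithZero S] {r x : S} {σ τ : Set S}

theorem IsString.ne_zero (hσ : IsString σ) (hx : x ∈ σ) : x ≠ 0 :=
  fun h => hσ.2.1 (h ▸ hx)

theorem IsString.starInv (hlc : ZeroLeftCancellative S) (hσ : IsString σ) (hx : r * x ∈ σ) :
    IsString (starInv r σ) := by
  refine ⟨⟨x, hx⟩, fun h => hσ.ne_zero h (mul_zero r),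
    fun s t hst ht => hσ.2.2.1 _ _ (hst.mul_left r) ht, fun s₁ h₁ s₂ h₂ => ?_⟩
  obtain ⟨s, hs, hd₁, hd₂⟩ := hσ.2.2.2 _ h₁ _ h₂
  obtain ⟨a, rfl, ha⟩ := hd₁.exists_eq_mul
  exact ⟨a, hs, ha, hd₂.of_mul_left hlc (hσ.ne_zero hs)⟩

theorem IsString.star (hτ : τ ∈ Fstar r) : IsString (star r τ) := by
  obtain ⟨hτ, h0⟩ := hτ
  obtain ⟨x, hx⟩ := hτ.1
  refine ⟨⟨r * x, x, hx, Divides.refl _⟩, ?_, ?_, ?_⟩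
  · rintro ⟨s, hs, hd⟩
    exact hd.ne_zero (h0 s hs) rfl
  · rintro s t hst ⟨u, hu, htu⟩
    exact ⟨u, hu, hst.trans htu⟩
  · rintro t₁ ⟨s₁, hs₁, h₁⟩ t₂ ⟨s₂, hs₂, h₂⟩
    obtain ⟨s, hs, hd₁, hd₂⟩ := hτ.2.2.2 _ hs₁ _ hs₂
    exact ⟨r * s, ⟨s, hs, Divides.refl _⟩, h₁.trans (hd₁.mul_left r), h₂.trans (hd₂.mul_left r)⟩

theorem IsString.mem_Fstar (hcat : ∀ r s t : S, r * s ≠ 0 → s * t ≠ 0 → r * (s * t) ≠ 0)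
    (hτ : IsString τ) (hx : x ∈ τ) (hrx : r * x ≠ 0) : τ ∈ Fstar r := by
  refine ⟨hτ, fun t ht => ?_⟩
  obtain ⟨m, hm, hxm, htm⟩ := hτ.2.2.2 _ hx _ ht
  refine (htm.mul_left r).ne_zero ?_
  rcases hxm with rfl | ⟨u, rfl⟩
  · exact hrx
  · exact hcat r x u hrx (hτ.ne_zero hm)

theorem IsString.subset_star (hσ : IsString σ) (hx : r * x ∈ σ) (hτ : _root_.starInv r σ ⊆ τ) :
    σ ⊆ _root_.star r τ := by
  intro y hy
  obtain ⟨z, hz, hxz, hyz⟩ := hσ.2.2.2 _ hx _ hy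
  obtain ⟨a, rfl, -⟩ := hxz.exists_eq_mul
  exact ⟨a, hτ hz, hyz⟩

end IsString

/-- If `S` is moreover categorical at zero and `σ` is a maximal string in the range
`E⋆_r` of `θ⋆_r`, then `θ⋆_r⁻¹(σ) = r⁻¹∗σ` is a maximal string. -/
theorem strings.backwardInvariance {S : Type*} [SemigroupWithZero S]
    (hlc : ZeroLeftCancellative S)
    (hcat : ∀ r s t : S, r * s ≠ 0 → s * t ≠ 0 → r * (s * t) ≠ 0)
    (r : S) (σ : Set S) (hσ : IsString σ)
    (hmax : ∀ τ : Set S, IsString τ → σ ⊆ τ → σ = τ)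
    (hE : σ ∈ Estar r) :
    IsString (starInv r σ) ∧
      ∀ τ : Set S, IsString τ → starInv r σ ⊆ τ → starInv r σ = τ := by
  obtain ⟨-, _, hx, x, rfl⟩ := hE
  refine ⟨hσ.starInv hlc hx, fun τ hτ hsub => hsub.antisymm fun t ht => ?_⟩
  have hF : τ ∈ Fstar r := hτ.mem_Fstar hcat (hsub hx) (hσ.ne_zero hx)
  have hstar : σ = star r τ := hmax _ (IsString.star hF) (hσ.subset_star hx hsub)
  change r * t ∈ σ
  rw [hstar]
  exact ⟨t, ht, Divides.refl _⟩
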